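/- The key access-control finite state machine of VRASED satisfies LTL Specification (1). Precisely: let the FSM have states {Run, Reset} and transition function δ given by δ(Run, in) = Reset if ¬(PC ∈ CR) ∧ R_en ∧ (D_addr ∈ KR) holds of the inputs `in`, and δ(Run, in) = Run otherwise; δ(Reset, in) = Run if PC = 0 and δ(Reset, in) = Reset otherwise. For any input trace satisfying Axiom A4, the run of this FSM satisfies G: { ¬(PC ∈ CR) ∧ R_en ∧ (D_addr ∈ KR) → reset }. -/

import Mathlib

/-- States of a two-state Run/Reset monitor FSM. -/
inductive S2 where
  | Run : S2
  | Reset : S2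
deriving DecidableEq

-- Transition function of a two-state Run/Reset monitor: from `Run` it moves to
-- `Reset` exactly when the violation condition `V` holds of the current inputs, and
-- from `Reset` it moves back to `Run` exactly when `PC = 0`.
open Classical in
noncomputable def twoStateDelta (V : ℕ → Prop) (PC : ℕ → ℕ) : S2 → ℕ → S2
  | S2.Run, t => if V t then S2.Reset else S2.Run
  | S2.Reset, t => if PC t = 0 then S2.Run else S2.Reset

/-- If the violation condition holds while `PC ≠ 0`, the monitor moves to `Reset`. -/
theorem twoStateDelta_eq_reset {V : ℕ → Prop} {PC : ℕ → ℕ} {t : ℕ} (hV : V t)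
    (hPC : PC t ≠ 0) (q : S2) : twoStateDelta V PC q t = S2.Reset := by
  cases q <;> simp [twoStateDelta, hV, hPC]

/-- The key access-control FSM of VRASED satisfies LTL Specification (1):
for any input trace satisfying Axiom A4, at every time,
¬(PC ∈ CR) ∧ R_en ∧ (D_addr ∈ KR) → reset, where reset(t) := (s(t) = Reset). -/
theorem key_access_control_fsm_satisfies_spec1
    (CRmin CRmax Kmin Kmax : ℕ)
    (PC Daddr DMAaddr : ℕ → ℕ)
    (irq Ren Wen DMAen : ℕ → Prop)
    (s : ℕ → S2)
    (hs0 : s 0 = S2.Reset)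
    (hstep : ∀ t : ℕ, s (t + 1) =
      twoStateDelta
        (fun u => ¬(CRmin ≤ PC u ∧ PC u ≤ CRmax) ∧ Ren u ∧ (Kmin ≤ Daddr u ∧ Daddr u ≤ Kmax))
        PC (s t) (t + 1))
    (hA4 : ∀ t : ℕ, PC t = 0 → ¬Ren t ∧ ¬Wen t ∧ ¬DMAen t ∧ ¬irq t) :
    ∀ t : ℕ,
      (¬(CRmin ≤ PC t ∧ PC t ≤ CRmax) ∧ Ren t ∧ (Kmin ≤ Daddr t ∧ Daddr t ≤ Kmax)) →
      s t = S2.Reset := by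
  rintro (_ | t) hV
  · exact hs0
  · rw [hstep]
    exact twoStateDelta_eq_reset hV (fun hPC => (hA4 _ hPC).1 hV.2.1) _
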